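/- arXiv:2010.03231 — 3 statements merged into one kernel-verified Lean document; each statement's English description precedes it below -/
import Mathlib

section
/- Let M ≥ 2 and S ≥ 1 be integers with 2S ≤ M, and let 𝒞 = C(M,2) − M·(S−1) be the number of 2-element subsets {i, j} of {0, 1, ..., M−1} whose circular distance min(|i−j|, M−|i−j|) is at least S. Then ⌊log₂ 𝒞⌋ = ⌊log₂ C(M,2)⌋ if and only if S ≤ S_max, where S_max = ⌊1 + (C(M,2) − 2^⌊log₂ C(M,2)⌋)/M⌋. -/
/-- Two-sided characterization: with `𝒞 = C(M,2) − M(S−1)`,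
`⌊log₂ 𝒞⌋ = ⌊log₂ C(M,2)⌋` iff `S ≤ S_max = ⌊1 + (C(M,2) − 2^⌊log₂ C(M,2)⌋)/M⌋`. -/
theorem stmt_5 (M S : ℕ) (hM : 2 ≤ M) (hS : 1 ≤ S) (hSM : 2 * S ≤ M)
    (C : ℕ) (hC : C = M.choose 2 - M * (S - 1)) :
    Nat.log 2 C = Nat.log 2 (M.choose 2)
      ↔ S ≤ 1 + (M.choose 2 - 2 ^ (Nat.log 2 (M.choose 2))) / M := by
  have h2 : M.choose 2 * 2 = M * (M - 1) := by
    rw [Nat.choose_two_right]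
    exact Nat.div_mul_cancel (Nat.even_mul_pred_self M).two_dvd
  have hlt : M * (S - 1) < M.choose 2 := by
    have : M * (2 * (S - 1)) < M * (M - 1) :=
      Nat.mul_lt_mul_of_pos_left (by omega) (by omega)
    have h3 : M * (2 * (S - 1)) = 2 * (M * (S - 1)) := by ring
    omega
  have hN : M.choose 2 ≠ 0 := by omega
  have hC0 : C ≠ 0 := by omega
  have hle : 2 ^ Nat.log 2 (M.choose 2) ≤ M.choose 2 := Nat.pow_log_le_self 2 hN
  have key : S ≤ 1 + (M.choose 2 - 2 ^ (Nat.log 2 (M.choose 2))) / M ↔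
      2 ^ Nat.log 2 (M.choose 2) ≤ C := by
    have h4 := Nat.le_div_iff_mul_le (x := S - 1)
      (y := M.choose 2 - 2 ^ (Nat.log 2 (M.choose 2))) (show 0 < M by omega)
    rw [mul_comm (S - 1) M] at h4
    constructor
    · intro h
      have := h4.1 (by omega)
      omega
    · intro h
      have := h4.2 (by omega)
      omega
  rw [key]
  constructor
  · intro h
    rw [← h]
    exact Nat.pow_log_le_self 2 hC0
  · intro h
    apply le_antisymm
    · exact Nat.log_mono_right (by omega)
    · exact Nat.le_log_of_pow_le (by norm_num) h
end

section
/- Let k ≥ 2 be an integer and M = 2^k. Then S_max = M/4 = 2^(k−2), where S_max = ⌊1 + (C(M,2) − 2^⌊log₂ C(M,2)⌋)/M⌋ and C(M,2) = M(M−1)/2. -/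
/-- For `M = 2^k` with `k ≥ 2`, the maximum separation
`S_max = ⌊1 + (C(M,2) − 2^⌊log₂ C(M,2)⌋)/M⌋` equals `M/4 = 2^(k−2)`. -/
theorem stmt_6 (k : ℕ) (hk : 2 ≤ k) (M : ℕ) (hM : M = 2 ^ k) :
    1 + (M.choose 2 - 2 ^ (Nat.log 2 (M.choose 2))) / M = M / 4
      ∧ M / 4 = 2 ^ (k - 2) := by
  obtain ⟨j, rfl⟩ := Nat.exists_eq_add_of_le hk
  have hp : 0 < 2 ^ j := by positivity
  have e1 : 2 ^ (2 * j + 2) = 4 * (2 ^ j * 2 ^ j) := by ring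
  have e2 : 2 ^ (2 * j + 2 + 1) = 8 * (2 ^ j * 2 ^ j) := by ring
  have hj : 2 + j - 2 = j := by omega
  have hM' : M = 4 * 2 ^ j := by rw [hM]; ring
  rw [hj]
  clear hM
  generalize 2 ^ j = a at *
  subst hM'
  obtain ⟨b, rfl⟩ : ∃ b, a = b + 1 := ⟨a - 1, by omega⟩
  have hC : (4 * (b + 1)).choose 2 = 8 * (b * b) + 14 * b + 6 := by
    rw [Nat.choose_two_right]
    apply Nat.div_eq_of_eq_mul_left (by norm_num)
    have : 4 * (b + 1) - 1 = 4 * b + 3 := by omega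
    rw [this]; ring
  have hlog : Nat.log 2 ((4 * (b + 1)).choose 2) = 2 * j + 2 := by
    rw [hC]
    apply Nat.log_eq_of_pow_le_of_lt_pow
    · rw [e1]; nlinarith
    · rw [e2]; nlinarith
  have hd : 4 * (b + 1) / 4 = b + 1 := by omega
  rw [hlog, hC, e1, hd]
  refine ⟨?_, rfl⟩
  have h1 : 8 * (b * b) + 14 * b + 6 - 4 * ((b + 1) * (b + 1)) = (2 * b + 2) + 4 * (b + 1) * b := by
    apply Nat.sub_eq_of_eq_add; ring
  rw [h1, Nat.add_mul_div_left _ _ (by omega), Nat.div_eq_of_lt (by omega)]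
  omega
end

section
/- Let k ≥ 1 be an integer and M = 2^k + 1. Then S_max = 1, where S_max = ⌊1 + (C(M,2) − 2^⌊log₂ C(M,2)⌋)/M⌋ and C(M,2) = M(M−1)/2. -/
/-- For `M = 2^k + 1` with `k ≥ 1`, the maximum separation
`S_max = ⌊1 + (C(M,2) − 2^⌊log₂ C(M,2)⌋)/M⌋` equals `1`. -/
theorem stmt_7 (k : ℕ) (hk : 1 ≤ k) (M : ℕ) (hM : M = 2 ^ k + 1) :
    1 + (M.choose 2 - 2 ^ (Nat.log 2 (M.choose 2))) / M = 1 := by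
  obtain ⟨j, rfl⟩ : ∃ j, k = j + 1 := ⟨k - 1, by omega⟩
  have ha : 1 ≤ 2 ^ j := Nat.one_le_two_pow
  have h1 : 2 ^ (2 * j + 1) = 2 * (2 ^ j * 2 ^ j) := by ring
  have h2 : 2 ^ (2 * j + 1 + 1) = 4 * (2 ^ j * 2 ^ j) := by ring
  have hM' : M = 2 * 2 ^ j + 1 := by rw [hM]; ring
  have hC : M.choose 2 = 2 * (2 ^ j * 2 ^ j) + 2 ^ j := by
    rw [Nat.choose_two_right, hM', Nat.add_sub_cancel]
    apply Nat.div_eq_of_eq_mul_left (by norm_num)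
    ring
  have hsq : 2 ^ j ≤ 2 ^ j * 2 ^ j := Nat.le_mul_of_pos_left _ ha
  have hlog : Nat.log 2 (M.choose 2) = 2 * j + 1 := by
    apply Nat.log_eq_of_pow_le_of_lt_pow
    · rw [h1, hC]; omega
    · rw [h2, hC]; omega
  rw [hlog, h1, hC, Nat.add_sub_cancel_left, Nat.div_eq_of_lt (by omega)]
end
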